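/- For every real s > 1 the series Z_{S²}(s) = Σ_{k=1}^{∞} (2k+1)·(4π·k(k+1))^{−s} converges, and the regularized trace of the round sphere of area 1 satisfies lim_{s→1⁺} (Z_{S²}(s) − 1/(4π(s−1))) = (1/(4π))·(2γ − 1 − log(4π)), where γ is the Euler–Mascheroni constant. -/

import Mathlib

open Real Filter Topology

/-- The spectral zeta function of the round sphere of area 1:
`Z_{S²}(s) = Σ_{k ≥ 1} (2k+1)(4πk(k+1))^{−s}` (indexed here by `k+1`, `k : ℕ`). -/
noncomputable def Zsphere (s : ℝ) : ℝ :=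
  ∑' k : ℕ, (2 * ((k : ℝ) + 1) + 1) * (4 * π * ((k : ℝ) + 1) * (((k : ℝ) + 1) + 1)) ^ (-s)

namespace SphereAux

noncomputable def D (s : ℝ) (k : ℕ) : ℝ :=
  (((k : ℝ) + 1) ^ (1 - s) - ((k : ℝ) + 1 + 1) ^ (1 - s)) *
    (((k : ℝ) + 1) ^ (-s) - ((k : ℝ) + 1 + 1) ^ (-s))

lemma key (s x y : ℝ) (hx : 0 < x) (hy : 0 < y) :
    (x + y) * (x * y) ^ (-s) = 1 / x ^ (2 * s - 1) + 1 / y ^ (2 * s - 1)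
      - (x ^ (1 - s) - y ^ (1 - s)) * (x ^ (-s) - y ^ (-s)) := by
  have e : ∀ z : ℝ, 0 < z → 1 / z ^ (2 * s - 1) = z * z ^ (-s) * z ^ (-s) := by
    intro z hz
    rw [one_div, ← rpow_neg hz.le, show -(2 * s - 1) = 1 + -s + -s by ring, rpow_add hz,
      rpow_add hz, rpow_one]
  have e2 : ∀ z : ℝ, 0 < z → z ^ (1 - s) = z * z ^ (-s) := by
    intro z hz
    rw [sub_eq_add_neg, rpow_add hz, rpow_one]
  rw [e x hx, e y hy, e2 x hx, e2 y hy, mul_rpow hx.le hy.le]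
  ring

lemma D_nonneg {s : ℝ} (hs : 1 < s) (k : ℕ) : 0 ≤ D s k := by
  unfold D
  apply mul_nonneg
  · rw [sub_nonneg]
    exact rpow_le_rpow_of_nonpos (by positivity) (by linarith) (by linarith)
  · rw [sub_nonneg]
    exact rpow_le_rpow_of_nonpos (by positivity) (by linarith) (by linarith)

lemma D_le {s : ℝ} (hs : 1 < s) (hs2 : s < 2) (k : ℕ) : D s k ≤ 2 * (1 / ((k : ℝ) + 1) ^ (2 : ℝ)) := by
  unfold D
  have hk : (0 : ℝ) ≤ k := k.cast_nonneg
  set x : ℝ := (k : ℝ) + 1 with hx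
  have hx1 : 1 ≤ x := by linarith
  have hx0 : 0 < x := by linarith
  have h1 : x ^ (1 - s) ≤ 1 := rpow_le_one_of_one_le_of_nonpos hx1 (by linarith)
  have h2 : 0 ≤ (x + 1) ^ (1 - s) := by positivity
  have h3 : (x + 1) ^ (-s) ≤ x ^ (-s) :=
    rpow_le_rpow_of_nonpos (by positivity) (by linarith) (by linarith)
  have h4 : x ^ (-s) ≤ x⁻¹ := by
    rw [← rpow_neg_one]
    exact rpow_le_rpow_of_exponent_le hx1 (by linarith)
  have h5 : (x + 1) ^ (-s) = x ^ (-s) * (x / (x + 1)) ^ s := by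
    rw [div_rpow hx0.le (by positivity), rpow_neg hx0.le, rpow_neg (by positivity)]
    have := (rpow_pos_of_pos hx0 s).ne'
    field_simp
  have h6 : (x / (x + 1)) ^ 2 ≤ (x / (x + 1)) ^ s := by
    rw [← rpow_two]
    exact rpow_le_rpow_of_exponent_ge (by positivity)
      ((div_le_one (by positivity)).2 (by linarith)) hs2.le
  have h7 : 1 - (x / (x + 1)) ^ 2 ≤ 2 * x⁻¹ := by
    rw [div_pow, ← sub_nonneg]
    have : 2 * x⁻¹ - (1 - x ^ 2 / (x + 1) ^ 2) = (3 * x + 2) / (x * (x + 1) ^ 2) := by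
      field_simp
      ring
    rw [this]; positivity
  have h8 : 0 ≤ x ^ (-s) := by positivity
  calc _ ≤ 1 * (x ^ (-s) - (x + 1) ^ (-s)) := by
        apply mul_le_mul_of_nonneg_right <;> linarith
    _ = x ^ (-s) * (1 - (x / (x + 1)) ^ s) := by rw [h5]; ring
    _ ≤ x ^ (-s) * (2 * x⁻¹) := by
        apply mul_le_mul_of_nonneg_left _ h8; linarith
    _ ≤ x⁻¹ * (2 * x⁻¹) := by gcongr
    _ = _ := by rw [rpow_two]; field_simp

lemma summ {t : ℝ} (ht : 1 < t) : Summable (fun n : ℕ => 1 / ((n : ℝ) + 1) ^ t) := by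
  exact_mod_cast (summable_nat_add_iff 1).mpr (summable_one_div_nat_rpow.mpr ht)

lemma summ' {t : ℝ} (ht : 1 < t) : Summable (fun n : ℕ => 1 / ((n : ℝ) + 1 + 1) ^ t) := by
  have := (summable_nat_add_iff 1).mpr (summ ht)
  simpa only [Nat.cast_add, Nat.cast_one] using this

noncomputable def a (s : ℝ) (k : ℕ) : ℝ :=
  (((k : ℝ) + 1) + ((k : ℝ) + 1 + 1)) * (((k : ℝ) + 1) * ((k : ℝ) + 1 + 1)) ^ (-s)

lemma a_eq (s : ℝ) (k : ℕ) : a s k =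
    1 / ((k : ℝ) + 1) ^ (2 * s - 1) + 1 / ((k : ℝ) + 1 + 1) ^ (2 * s - 1) - D s k :=
  key s _ _ (by positivity) (by positivity)

lemma a_summable {s : ℝ} (hs : 1 < s) : Summable (a s) := by
  refine Summable.of_nonneg_of_le (fun k => ?_) (fun k => ?_)
    ((summ (t := 2 * s - 1) (by linarith)).add (summ' (t := 2 * s - 1) (by linarith)))
  · unfold a; positivity
  · rw [a_eq]; linarith [D_nonneg hs k]

lemma D_summable {s : ℝ} (hs : 1 < s) : Summable (D s) := by
  have := ((summ (t := 2 * s - 1) (by linarith)).add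
    (summ' (t := 2 * s - 1) (by linarith))).sub (a_summable hs)
  refine this.congr fun k => ?_
  rw [a_eq]; ring

lemma a_tsum {s : ℝ} (hs : 1 < s) : ∑' k, a s k =
    2 * (∑' n : ℕ, 1 / ((n : ℝ) + 1) ^ (2 * s - 1)) - 1 - ∑' k, D s k := by
  have ht : 1 < 2 * s - 1 := by linarith
  simp_rw [a_eq]
  rw [((summ ht).add (summ' ht)).tsum_sub (D_summable hs), (summ ht).tsum_add (summ' ht)]
  have := (summ ht).tsum_eq_zero_add
  simp only [Nat.cast_add, Nat.cast_one, Nat.cast_zero, zero_add, one_rpow, div_one] at this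
  linarith

lemma D_tendsto : Tendsto (fun s => ∑' k, D s k) (𝓝[>] 1) (𝓝 0) := by
  have := tendsto_tsum_of_dominated_convergence (f := D) (g := fun _ => 0) (𝓕 := 𝓝[>] (1 : ℝ))
    ((summ (t := 2) (by norm_num)).mul_left 2) ?_ ?_
  · simpa using this
  · intro k
    have hc : ContinuousAt (fun s => D s k) 1 := by
      have hx : ((k : ℝ) + 1) ≠ 0 := by positivity
      have hy : ((k : ℝ) + 1 + 1) ≠ 0 := by positivity
      unfold D
      refine ContinuousAt.mul (ContinuousAt.sub ?_ ?_) (ContinuousAt.sub ?_ ?_) <;>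
      exact continuousAt_const.rpow (by fun_prop) (Or.inl (by assumption))
    have h0 : D 1 k = 0 := by simp [D]
    have := hc.tendsto
    rw [h0] at this
    exact this.mono_left nhdsWithin_le_nhds
  · filter_upwards [Ioo_mem_nhdsGT (show (1 : ℝ) < 2 by norm_num)] with s hs k
    rw [Real.norm_of_nonneg (D_nonneg hs.1 k)]
    exact D_le hs.1 hs.2 k

lemma zeta_tendsto : Tendsto (fun s : ℝ ↦ (∑' n : ℕ, 1 / (n + 1 : ℝ) ^ s) - 1 / (s - 1))
    (𝓝[>] 1) (𝓝 Real.eulerMascheroniConstant) := by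
  have := (Complex.continuous_re.tendsto _).comp
    ZetaAsymptotics.tendsto_riemannZeta_sub_one_div_nhds_right
  rw [Complex.ofReal_re] at this
  refine this.congr' ?_
  filter_upwards [self_mem_nhdsWithin] with s hs
  rw [Function.comp_apply, ← Complex.ofReal_re ((∑' n : ℕ, 1 / (n + 1 : ℝ) ^ s) - 1 / (s - 1))]
  congr 1
  simp only [Complex.ofReal_sub, Complex.ofReal_div,
      Complex.ofReal_one, sub_left_inj, Complex.ofReal_tsum]
  rw [zeta_eq_tsum_one_div_nat_add_one_cpow (by simpa using hs)]
  congr 1 with n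
  rw [Complex.ofReal_cpow (by positivity)]
  norm_cast

lemma A_tendsto : Tendsto (fun s => ∑' k, a s k - 1 / (s - 1)) (𝓝[>] 1)
    (𝓝 (2 * Real.eulerMascheroniConstant - 1)) := by
  have hm : Tendsto (fun s : ℝ => 2 * s - 1) (𝓝[>] 1) (𝓝[>] 1) := by
    refine tendsto_nhdsWithin_iff.2 ⟨?_, ?_⟩
    · have : ContinuousAt (fun s : ℝ => 2 * s - 1) 1 := by fun_prop
      have := this.tendsto
      norm_num at this
      exact this.mono_left nhdsWithin_le_nhds
    · filter_upwards [self_mem_nhdsWithin] with s hs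
      simp only [Set.mem_Ioi] at *
      linarith
  have := (((zeta_tendsto.comp hm).const_mul 2).sub_const 1).sub D_tendsto
  rw [sub_zero] at this
  refine this.congr' ?_
  filter_upwards [self_mem_nhdsWithin] with s hs
  have hs' : s - 1 ≠ 0 := (sub_pos.2 hs).ne'
  rw [a_tsum hs, Function.comp_apply, show 2 * s - 1 - 1 = 2 * (s - 1) by ring]
  field_simp
  ring

lemma term_eq (s : ℝ) (k : ℕ) :
    (2 * ((k : ℝ) + 1) + 1) * (4 * π * ((k : ℝ) + 1) * (((k : ℝ) + 1) + 1)) ^ (-s)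
      = (4 * π) ^ (-s) * a s k := by
  have := pi_pos
  rw [a, mul_assoc (4 * π), mul_rpow (by positivity) (by positivity)]
  ring

end SphereAux

open SphereAux in
/-- For every real `s > 1` the series converges, and the regularized trace of the round
sphere of area 1 is `lim_{s→1⁺}(Z_{S²}(s) − 1/(4π(s−1))) = (1/(4π))(2γ − 1 − log(4π))`. -/
theorem sphere_regularized_trace :
    (∀ s : ℝ, 1 < s →
      Summable (fun k : ℕ =>
        (2 * ((k : ℝ) + 1) + 1) * (4 * π * ((k : ℝ) + 1) * (((k : ℝ) + 1) + 1)) ^ (-s))) ∧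
      Tendsto (fun s : ℝ => Zsphere s - 1 / (4 * π * (s - 1))) (𝓝[>] 1)
        (𝓝 ((1 / (4 * π)) * (2 * Real.eulerMascheroniConstant - 1 - log (4 * π)))) := by
  have hp : (0 : ℝ) < 4 * π := by have := pi_pos; positivity
  constructor
  · intro s hs
    simp_rw [term_eq]
    exact (a_summable hs).mul_left _
  · have hd : HasDerivAt (fun s : ℝ => (4 * π) ^ (-s)) (-(log (4 * π)) * (4 * π) ^ (-1 : ℝ)) 1 := by
      have := (hasDerivAt_neg (1 : ℝ)).const_rpow hp
      convert this using 1
      ring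
    have h1 : Tendsto (fun s : ℝ => (4 * π) ^ (-s)) (𝓝[>] 1) (𝓝 ((4 * π) ^ (-1 : ℝ))) :=
      hd.continuousAt.tendsto.mono_left nhdsWithin_le_nhds
    have h2 := (hasDerivAt_iff_tendsto_slope.1 hd).mono_left
      (nhdsWithin_mono 1 (fun x (hx : 1 < x) => hx.ne') : 𝓝[>] (1 : ℝ) ≤ _)
    have h3 := (h1.mul A_tendsto).add h2
    have e : (4 * π) ^ (-1 : ℝ) * (2 * Real.eulerMascheroniConstant - 1) +
        -(log (4 * π)) * (4 * π) ^ (-1 : ℝ) =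
        (1 / (4 * π)) * (2 * Real.eulerMascheroniConstant - 1 - log (4 * π)) := by
      rw [rpow_neg_one]; ring
    rw [e] at h3
    refine h3.congr' ?_
    filter_upwards [self_mem_nhdsWithin] with s hs
    have hs' : s - 1 ≠ 0 := (sub_pos.2 hs).ne'
    have hZ : Zsphere s = (4 * π) ^ (-s) * ∑' k, a s k := by
      unfold Zsphere
      simp_rw [term_eq]
      exact tsum_mul_left
    rw [hZ, slope_def_field, rpow_neg_one]
    generalize (4 * π) ^ (-s) = u
    field_simp
    ring
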